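/- There is an absolute constant K > 0 such that the following holds. Let m be a square-free positive integer, p_1 = P^-(m) its least prime factor, t = ω(m) the number of its prime factors, and let C_1, C_2 be disjoint sets of non-negative integers all less than p_1, with |C_1| = s_1 and |C_2| = s_2. Then for every r ∈ N: ||RN_m(C_1,C_2)| − m·2^{−s_1 t}·(1 − 2^{−t})^{s_2}| ≤ K·m·2^{−s_1 t}·(E_1 + E_2), where E_1 = Σ_{k=0}^{min(r,s_2)} C(s_2,k)·2^{−kt}·E(s_1+k), E(ν) = Σ_{d | m, d > 1} (ν·2^ν)^{ω(d)}/√d, and E_2 = Σ_{k=r}^{s_2} C(s_2,k)·2^{−kt} (with E_2 = 0 when r > s_2). -/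

import Mathlib

open Finset

/-- The set of quadratic residues modulo `M`, as a finset of `ZMod M`. -/
def QR (M : ℕ) : Finset (ZMod M) := (Finset.range M).image (fun a : ℕ => ((a : ZMod M)) ^ 2)

/-- The "universe" finset of `ZMod M` (all residues), valid for any `M ≥ 1`. -/
def univM (M : ℕ) : Finset (ZMod M) := (Finset.range M).image (fun a : ℕ => (a : ZMod M))

/-- `RN_M(C₁, C₂)` for `C₁, C₂ ⊆ Z_M`: the set of `x ∈ Z_M` with `x + c₁ ∈ R_M` for all
`c₁ ∈ C₁` and `x + c₂ ∉ R_M` for all `c₂ ∈ C₂`. -/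
def RNsetZ (M : ℕ) (C₁ C₂ : Finset (ZMod M)) : Finset (ZMod M) :=
  (univM M).filter (fun x => (∀ c ∈ C₁, x + c ∈ QR M) ∧ (∀ c ∈ C₂, x + c ∉ QR M))

/-- `RN_M(C₁, C₂)` for sets `C₁, C₂` of non-negative integers, identified with their
residues in `Z_M`. -/
def RNset (M : ℕ) (C₁ C₂ : Finset ℕ) : Finset (ZMod M) :=
  (univM M).filter
    (fun x => (∀ c ∈ C₁, x + (c : ZMod M) ∈ QR M) ∧ (∀ c ∈ C₂, x + (c : ZMod M) ∉ QR M))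

/-- `N_M(C)` for a set `C` of non-negative integers (identified with residues in `Z_M`):
the set of `x ∈ Z_M` with `x + c ∉ R_M` for all `c ∈ C`. -/
def Nset (M : ℕ) (C : Finset ℕ) : Finset (ZMod M) :=
  (univM M).filter (fun x => ∀ c ∈ C, x + (c : ZMod M) ∉ QR M)

/-- `E(ν) = Σ_(d ∣ m, d > 1) (ν·2^ν)^(ω(d)) / √d`. -/
noncomputable def Efun (m ν : ℕ) : ℝ :=
  ∑ d ∈ m.divisors.filter (fun d => 1 < d),
    ((ν : ℝ) * 2 ^ ν) ^ (d.primeFactors.card) / Real.sqrt d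

section TwistedDerivative

open Polynomial

variable {K : Type*} [Field K]

/-- The operator `r ↦ f * D r + e * D f * r`, where `D` is the derivative, so that
`D (f ^ (e + 1) * r) = f ^ e * twistedDerivative f (e + 1) r`. -/
noncomputable def twistedDerivative (f : K[X]) (e : ℕ) : K[X] →ₗ[K] K[X] :=
  LinearMap.mulLeft K f ∘ₗ derivative + (e : K) • LinearMap.mulLeft K (derivative f)

/-- The `k`-fold composition of twisted derivatives describing the `k`-th derivative of
`f ^ e * r`. -/
noncomputable def twistedDerivativeIter (f : K[X]) (e : ℕ) : ℕ → K[X] →ₗ[K] K[X]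
  | 0 => LinearMap.id
  | k + 1 => twistedDerivative f (e - k) ∘ₗ twistedDerivativeIter f e k

theorem twistedDerivative_apply (f r : K[X]) (e : ℕ) :
    twistedDerivative f e r = f * derivative r + (e : K[X]) * (derivative f * r) := by
  simp [twistedDerivative, smul_eq_C_mul]

theorem iterate_derivative_pow_mul (f r : K[X]) {e k : ℕ} (hk : k ≤ e) :
    derivative^[k] (f ^ e * r) = f ^ (e - k) * twistedDerivativeIter f e k r := by
  induction k with
  | zero => simp [twistedDerivativeIter]
  | succ k ih =>
    obtain ⟨d, rfl⟩ : ∃ d, e = k + 1 + d := ⟨e - (k + 1), by omega⟩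
    rw [Function.iterate_succ_apply', ih (by omega)]
    have h1 : k + 1 + d - k = d + 1 := by omega
    have h2 : k + 1 + d - (k + 1) = d := by omega
    simp only [twistedDerivativeIter, LinearMap.comp_apply, twistedDerivative_apply, h1, h2,
      derivative_mul, derivative_pow, Nat.add_sub_cancel, map_natCast]
    ring

theorem natDegree_twistedDerivative_le (f r : K[X]) (e : ℕ) (hf : 1 ≤ f.natDegree) :
    (twistedDerivative f e r).natDegree ≤ r.natDegree + (f.natDegree - 1) := by
  rw [twistedDerivative_apply]
  refine (natDegree_add_le _ _).trans (max_le ?_ ?_)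
  · rcases Nat.eq_zero_or_pos r.natDegree with h | h
    · rw [natDegree_eq_zero.mp h |>.choose_spec.symm]
      simp
    · refine natDegree_mul_le.trans ?_
      have := natDegree_derivative_le r
      omega
  · refine natDegree_mul_le.trans ?_
    have h1 : (derivative f * r).natDegree ≤ _ := natDegree_mul_le
    have h2 := natDegree_derivative_le f
    rw [natDegree_natCast]
    omega

theorem natDegree_twistedDerivativeIter_le (f r : K[X]) (e k : ℕ) (hf : 1 ≤ f.natDegree) :
    (twistedDerivativeIter f e k r).natDegree ≤ r.natDegree + k * (f.natDegree - 1) := by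
  induction k with
  | zero => simp [twistedDerivativeIter]
  | succ k ih =>
    have h := natDegree_twistedDerivative_le f (twistedDerivativeIter f e k r) (e - k) hf
    rw [add_mul, one_mul, ← add_assoc]
    exact h.trans (Nat.add_le_add_right ih _)

theorem twistedDerivativeIter_mul_X_pow (p : ℕ) [CharP K p] (f r : K[X]) (e k j : ℕ) :
    twistedDerivativeIter f e k (r * X ^ (p * j)) =
      twistedDerivativeIter f e k r * X ^ (p * j) := by
  induction k with
  | zero => simp [twistedDerivativeIter]
  | succ k ih =>
    have hX : derivative (X ^ (p * j) : K[X]) = 0 := by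
      simp [derivative_X_pow]
    simp only [twistedDerivativeIter, LinearMap.comp_apply, ih, twistedDerivative_apply,
      derivative_mul, hX]
    ring

theorem exists_ne_zero_forall_sum_smul_eq_zero {I : Type*} [Fintype I] {l : ℕ}
    (w : Fin l → I → K[X]) (d : Fin l → ℕ) (hw : ∀ k i, (w k i).natDegree < d k)
    (hcard : ∑ k, d k < Fintype.card I) :
    ∃ v : I → K, v ≠ 0 ∧ ∀ k, ∑ i, v i • w k i = 0 := by
  let L : (I → K) →ₗ[K] ((Σ k : Fin l, Fin (d k)) → K) :=
    LinearMap.pi fun s => lcoeff K s.2 ∘ₗ Fintype.linearCombination K (w s.1)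
  have hL : LinearMap.ker L ≠ ⊥ := by
    apply LinearMap.ker_ne_bot_of_finrank_lt
    simpa [Fintype.card_sigma] using hcard
  obtain ⟨v, hv, hv0⟩ := (Submodule.ne_bot_iff _).mp hL
  refine ⟨v, hv0, fun k => ?_⟩
  have hdeg : (∑ i, v i • w k i).natDegree ≤ d k - 1 :=
    natDegree_sum_le_of_forall_le _ _ fun i _ =>
      (natDegree_smul_le _ _).trans (Nat.le_sub_one_of_lt (hw k i))
  have hpos : ∀ _ : I, 0 < d k := fun i => (Nat.zero_le _).trans_lt (hw k i)
  ext N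
  rw [coeff_zero]
  by_cases hN : N < d k
  · have := congrFun (LinearMap.mem_ker.mp hv) ⟨k, ⟨N, hN⟩⟩
    simpa [L, Fintype.linearCombination_apply] using this
  · rcases isEmpty_or_nonempty I with hI | ⟨⟨i⟩⟩
    · simp
    · exact coeff_eq_zero_of_natDegree_lt (by have := hpos i; omega)

theorem eq_zero_and_eq_zero_of_add_X_pow_mul_eq_zero {p m : ℕ} (hp : p = 2 * m + 1) (A B u : K[X])
    (hu : u.coeff 0 ≠ 0) (hA : ∀ N, A.coeff N ≠ 0 → N % p < m)
    (hB : ∀ N, B.coeff N ≠ 0 → N % p ≤ m) (h : A + X ^ m * u * B = 0) : A = 0 ∧ B = 0 := by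
  have hB0 : B = 0 := by
    by_contra hB0
    have hu0 : u ≠ 0 := by
      rintro rfl
      simp at hu
    have hA0 : A ≠ 0 := by
      rintro rfl
      simp [hu0, hB0] at h
    have htu : u.natTrailingDegree = 0 := Nat.le_zero.mp (natTrailingDegree_le_of_ne_zero hu)
    have hAB : A = -(u * B * X ^ m) := by linear_combination h
    have ht : A.natTrailingDegree = B.natTrailingDegree + m := by
      rw [hAB, natTrailingDegree_neg, natTrailingDegree_mul_X_pow (mul_ne_zero hu0 hB0),
        natTrailingDegree_mul hu0 hB0, htu, zero_add]
    have h1 := hA _ (by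
      rw [← trailingCoeff]; exact mt trailingCoeff_eq_zero.mp hA0)
    have h2 := hB _ (by
      rw [← trailingCoeff]; exact mt trailingCoeff_eq_zero.mp hB0)
    rw [ht, Nat.add_mod, Nat.mod_eq_of_lt (show m < p by omega),
      Nat.mod_eq_of_lt (by omega)] at h1
    omega
  subst hB0
  exact ⟨by simpa using h, rfl⟩

theorem coeff_sum_smul_X_pow_mul_X_pow {p s R : ℕ} (hs : s ≤ p) (v : Fin R × Fin s → K)
    (N : ℕ) :
    (∑ i, v i • (X ^ (i.2 : ℕ) * X ^ (p * i.1) : K[X])).coeff N ≠ 0 → N % p < s := by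
  intro h
  rw [finsetSum_coeff] at h
  obtain ⟨i, -, hi⟩ := Finset.exists_ne_zero_of_sum_ne_zero h
  rw [← pow_add, coeff_smul, coeff_X_pow] at hi
  have hN : N = i.2 + p * i.1 := by
    by_contra hN
    simp [hN] at hi
  have := i.2.2
  rw [hN, Nat.add_mul_mod_self_left, Nat.mod_eq_of_lt (by omega)]
  exact this

theorem eq_zero_of_sum_smul_X_pow_mul_X_pow {p s R : ℕ} (hs : s ≤ p) (v : Fin R × Fin s → K)
    (h : ∑ i, v i • (X ^ (i.2 : ℕ) * X ^ (p * i.1) : K[X]) = 0) : v = 0 := by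
  funext i
  have hi := congrArg (fun q => coeff q (i.2 + p * i.1)) h
  simp only [finsetSum_coeff, coeff_zero, ← pow_add, coeff_smul, coeff_X_pow] at hi
  rw [Finset.sum_eq_single i] at hi
  · simpa using hi
  · intro j _ hj
    rw [if_neg, smul_zero]
    intro hij
    apply hj
    have h1 := j.2.2
    have h2 := i.2.2
    have hmod := congrArg (· % p) hij
    simp only [Nat.add_mul_mod_self_left] at hmod
    rw [Nat.mod_eq_of_lt (by omega), Nat.mod_eq_of_lt (by omega)] at hmod
    have hdiv : p * (i.1 : ℕ) = p * j.1 := by omega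
    have := Nat.eq_of_mul_eq_mul_left (by omega) hdiv
    exact Prod.ext (Fin.ext this.symm) (Fin.ext hmod.symm)
  · simp

end TwistedDerivative

section Stepanov

open Polynomial

/-- If a nonzero polynomial vanishes to order `l` at each point of `Z`, then `l * #Z` is at most
its degree. -/
theorem mul_card_le_natDegree {K : Type*} [Field K] {P : K[X]} (Z : Finset K)
    (l : ℕ) (hZ : ∀ x ∈ Z, l ≤ P.rootMultiplicity x) : l * #Z ≤ P.natDegree := by
  classical
  calc l * #Z = ∑ x ∈ Z, l := by rw [sum_const, smul_eq_mul, mul_comm]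
    _ ≤ ∑ x ∈ Z, P.roots.count x := sum_le_sum fun x hx => by
        rw [count_roots]; exact hZ x hx
    _ ≤ ∑ x ∈ Z ∪ P.roots.toFinset, P.roots.count x :=
        sum_le_sum_of_subset subset_union_left
    _ = P.roots.card := Multiset.sum_count_eq_card fun x hx =>
        mem_union_right _ (Multiset.mem_toFinset.mpr hx)
    _ ≤ P.natDegree := card_roots' P

theorem stepanov_mul_card_le {p : ℕ} [Fact p.Prime] {m : ℕ} (hp : p = 2 * m + 1)
    {f u : (ZMod p)[X]} (hf : f = X * u) (hu : u.coeff 0 ≠ 0) (hn : 1 ≤ f.natDegree)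
    (a : ZMod p) {l J R : ℕ} (hJR : f.natDegree * m + p * J ≤ p * R) (hl : l ≤ p)
    (hcard : ∑ k ∈ range l, (m + k * (f.natDegree - 1) + R) < R * m + J * (m + 1))
    (Z : Finset (ZMod p)) (hZ : ∀ x ∈ Z, f.eval x ≠ 0 ∧ f.eval x ^ m = a) :
    l * #Z + p ≤ m + p * R := by
  have hp0 : 0 < p := by omega
  have hJ : J ≤ R := Nat.le_of_mul_le_mul_left (by omega : p * J ≤ p * R) hp0
  have hR : 1 ≤ R := by
    by_contra h
    have h1 : R = 0 := by omega
    have h2 : J = 0 := by omega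
    simp [h1, h2] at hcard
  set n := f.natDegree with hn_def
  have hf0 : f ≠ 0 := by
    rintro h
    rw [h] at hn_def
    simp at hn_def
    omega
  let w : Fin l → ((Fin R × Fin m) ⊕ (Fin J × Fin (m + 1))) → (ZMod p)[X] := fun k =>
    Sum.elim (fun i => twistedDerivativeIter f l k (X ^ (i.2 : ℕ)) * X ^ (i.1 : ℕ))
      (fun i => C a * (twistedDerivativeIter f (l + m) k (X ^ (i.2 : ℕ)) * X ^ (i.1 : ℕ)))
  obtain ⟨v, hv0, hv⟩ := exists_ne_zero_forall_sum_smul_eq_zero w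
    (fun k => m + k * (n - 1) + R) (by
      rintro k (i | i)
      · have h1 := i.1.2
        have h2 := i.2.2
        have h3 := natDegree_twistedDerivativeIter_le f (X ^ (i.2 : ℕ)) l k hn
        rw [natDegree_X_pow, ← hn_def] at h3
        refine lt_of_le_of_lt (natDegree_mul_le) ?_
        rw [natDegree_X_pow]
        omega
      · have h1 := i.1.2
        have h2 := i.2.2
        have h3 := natDegree_twistedDerivativeIter_le f (X ^ (i.2 : ℕ)) (l + m) k hn
        rw [natDegree_X_pow, ← hn_def] at h3
        refine lt_of_le_of_lt ((natDegree_C_mul_le _ _).trans natDegree_mul_le) ?_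
        rw [natDegree_X_pow]
        omega) (by
      rw [Fin.sum_univ_eq_sum_range (fun k => m + k * (n - 1) + R)]
      simpa using hcard)
  set A : (ZMod p)[X] :=
    ∑ i : Fin R × Fin m, v (Sum.inl i) • (X ^ (i.2 : ℕ) * X ^ (p * i.1)) with hA
  set B : (ZMod p)[X] :=
    ∑ i : Fin J × Fin (m + 1), v (Sum.inr i) • (X ^ (i.2 : ℕ) * X ^ (p * i.1)) with hB
  have hP0 : A + f ^ m * B ≠ 0 := by
    intro h
    rw [hf, mul_pow] at h
    have hum : (u ^ m).coeff 0 ≠ 0 := by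
      rw [coeff_zero_eq_eval_zero] at hu ⊢
      rw [eval_pow]
      exact pow_ne_zero _ hu
    obtain ⟨h1, h2⟩ := eq_zero_and_eq_zero_of_add_X_pow_mul_eq_zero hp A B (u ^ m) hum
      (coeff_sum_smul_X_pow_mul_X_pow (by omega) fun i => v (Sum.inl i))
      (fun N hN => Nat.lt_succ_iff.mp
        (coeff_sum_smul_X_pow_mul_X_pow (by omega) (fun i => v (Sum.inr i)) N hN)) h
    apply hv0
    funext i
    rcases i with i | i
    · exact congrFun (eq_zero_of_sum_smul_X_pow_mul_X_pow (by omega)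
        (fun i => v (Sum.inl i)) h1) i
    · exact congrFun (eq_zero_of_sum_smul_X_pow_mul_X_pow (by omega)
        (fun i => v (Sum.inr i)) h2) i
  have hdeg : (A + f ^ m * B).natDegree + p ≤ m + p * R := by
    have hpR : p ≤ p * R := Nat.le_mul_of_pos_right _ hR
    have key : ∀ i j : ℕ, i ≤ m → j < R → i + p * j ≤ m + p * R - p := by
      intro i j hi hj
      have : p * (j + 1) ≤ p * R := Nat.mul_le_mul_left _ hj
      rw [mul_add] at this
      omega
    have h : (A + f ^ m * B).natDegree ≤ m + p * R - p := by
      refine (natDegree_add_le _ _).trans (max_le ?_ ?_)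
      · refine natDegree_sum_le_of_forall_le _ _ fun i _ => (natDegree_smul_le _ _).trans ?_
        rw [← pow_add, natDegree_X_pow]
        exact key _ _ i.2.2.le i.1.2
      · rw [mul_sum]
        refine natDegree_sum_le_of_forall_le _ _ fun i _ => ?_
        rw [mul_smul_comm, ← pow_add]
        refine (natDegree_smul_le _ _).trans (natDegree_mul_le.trans ?_)
        rw [natDegree_X_pow, natDegree_pow, ← hn_def]
        have h1 := i.2.2
        have h2 : p * ((i.1 : ℕ) + 1) ≤ p * J := Nat.mul_le_mul_left _ i.1.2
        rw [mul_add] at h2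
        rw [mul_comm m n]
        omega
    omega
  have hvan : ∀ x ∈ Z, l ≤ (A + f ^ m * B).rootMultiplicity x := by
    intro x hx
    obtain ⟨hx0, hxa⟩ := hZ x hx
    have hfl : f ^ l * (A + f ^ m * B) ≠ 0 := mul_ne_zero (pow_ne_zero _ hf0) hP0
    have hmul : (f ^ l * (A + f ^ m * B)).rootMultiplicity x =
        (A + f ^ m * B).rootMultiplicity x := by
      rw [rootMultiplicity_mul hfl, rootMultiplicity_eq_zero (p := f ^ l), zero_add]
      rw [IsRoot, eval_pow]
      exact pow_ne_zero _ hx0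
    rw [← hmul]
    rcases Nat.eq_zero_or_pos l with h0 | hlpos
    · omega
    suffices l - 1 < (f ^ l * (A + f ^ m * B)).rootMultiplicity x by omega
    refine lt_rootMultiplicity_of_isRoot_iterate_derivative_of_mem_nonZeroDivisors' hfl ?_ ?_
    · intro k hk
      have hkl : k < l := by omega
      have hsplit : f ^ l * (A + f ^ m * B) = f ^ l * A + f ^ (l + m) * B := by ring
      rw [hsplit, iterate_map_add, iterate_derivative_pow_mul _ _ hkl.le,
        iterate_derivative_pow_mul _ _ (by omega), show l + m - k = l - k + m by omega,
        pow_add, mul_assoc, ← mul_add, IsRoot, eval_mul]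
      have hq := congrArg (eval x) (hv ⟨k, hkl⟩)
      have hxp : ∀ j : ℕ, x ^ (p * j) = x ^ j := fun j => by
        rw [pow_mul, ZMod.pow_card]
      have hAe : eval x (twistedDerivativeIter f l k A) = ∑ i : Fin R × Fin m,
          v (Sum.inl i) * (eval x (twistedDerivativeIter f l k (X ^ (i.2 : ℕ))) * x ^ (i.1 : ℕ)) := by
        simp only [hA, map_sum, map_smul, twistedDerivativeIter_mul_X_pow, eval_finsetSum,
          eval_smul, eval_mul, eval_pow, eval_X, hxp, smul_eq_mul]
      have hBe : eval x (twistedDerivativeIter f (l + m) k B) = ∑ i : Fin J × Fin (m + 1),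
          v (Sum.inr i) *
            (eval x (twistedDerivativeIter f (l + m) k (X ^ (i.2 : ℕ))) * x ^ (i.1 : ℕ)) := by
        simp only [hB, map_sum, map_smul, twistedDerivativeIter_mul_X_pow, eval_finsetSum,
          eval_smul, eval_mul, eval_pow, eval_X, hxp, smul_eq_mul]
      have : eval x (twistedDerivativeIter f l k A + f ^ m * twistedDerivativeIter f (l + m) k B)
          = 0 := by
        rw [eval_add, eval_mul, eval_pow, hxa, hAe, hBe, mul_sum]
        simp only [w, Fintype.sum_sum_type, Sum.elim_inl, Sum.elim_inr, eval_add,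
          eval_finsetSum, eval_smul, eval_mul, eval_pow, eval_X, eval_C, smul_eq_mul,
          eval_zero] at hq
        rw [← hq]
        congr 1
        refine sum_congr rfl fun i _ => ?_
        ring
      rw [this, mul_zero]
    · intro k hk hk0
      refine mem_nonZeroDivisors_of_ne_zero fun h => ?_
      rw [ZMod.natCast_eq_zero_iff] at h
      exact absurd (Nat.le_of_dvd (by omega) h) (by omega)
  have := mul_card_le_natDegree Z l hvan
  omega

end Stepanov

section CharacterSums

theorem exists_stepanov_parameter (m n h l : ℕ) (hl : l < 2 * m + 1) (hhl : h ≤ l) :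
    ∃ J : ℕ,
      ∑ k ∈ range l, (m + k * (n - 1) + (J + 1 + h)) < (J + 1 + h) * m + (J + 1) * (m + 1) ∧
      (J + h) * m + J * (m + 1) ≤ ∑ k ∈ range l, (m + k * (n - 1) + (J + h)) := by
  classical
  let P : ℕ → Prop := fun J =>
    ∑ k ∈ range l, (m + k * (n - 1) + (J + h)) < (J + h) * m + J * (m + 1)
  have hex : ∃ J, P J := by
    refine ⟨∑ k ∈ range l, (m + k * (n - 1) + h) + 1, ?_⟩
    simp only [P]
    have hS : ∀ S, ∑ k ∈ range l, (m + k * (n - 1) + (S + 1 + h)) =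
        ∑ k ∈ range l, (m + k * (n - 1) + h) + l * (S + 1) := by
      intro S
      simp only [sum_add_distrib, sum_const, card_range, smul_eq_mul]
      ring
    rw [hS]
    generalize ∑ k ∈ range l, (m + k * (n - 1) + h) = S
    nlinarith
  have h0 : ¬ P 0 := by
    simp only [P, not_lt, zero_add, zero_mul, add_zero]
    calc h * m ≤ ∑ _k ∈ range l, m := by
          rw [sum_const, card_range, smul_eq_mul]; exact Nat.mul_le_mul_right _ hhl
      _ ≤ _ := sum_le_sum fun k _ => by omega
  obtain ⟨J, hJ⟩ : ∃ J, Nat.find hex = J + 1 :=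
    Nat.exists_eq_succ_of_ne_zero fun h => h0 (h ▸ Nat.find_spec hex)
  refine ⟨J, ?_, ?_⟩
  · have := Nat.find_spec hex
    rw [hJ] at this
    exact this
  · exact not_lt.mp (Nat.find_min hex (m := J) (by omega))

theorem two_mul_sub_le_of_stepanov {p m n h l J N : ℕ} (hp : p = 2 * m + 1) (hn : 1 ≤ n)
    (h1 : n ≤ 2 * h) (h2 : 2 * h ≤ n + 1) (hhl : h ≤ l) (hl : 6 ≤ l) (hlp : l * l ≤ p)
    (hpl : p ≤ l * l + 2 * l)
    (hJ : (J + h) * m + J * (m + 1) ≤ ∑ k ∈ range l, (m + k * (n - 1) + (J + h)))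
    (hN : l * N + p ≤ m + p * (J + 1 + h)) :
    2 * (N : ℝ) - p ≤ (n + h + 1) * (l + 1.2) + 4 := by
  obtain ⟨n, rfl⟩ : ∃ k, n = k + 1 := ⟨n - 1, by omega⟩
  have hsum : 2 * ∑ k ∈ range l, (m + k * (n + 1 - 1) + (J + h)) =
      2 * l * (m + J + h) + n * (l * (l - 1)) := by
    rw [← Finset.sum_range_id_mul_two]
    simp only [sum_add_distrib, sum_const, card_range, smul_eq_mul, Nat.add_sub_cancel,
      ← sum_mul]
    ring
  have hJ' : 2 * ((J + h) * m + J * (m + 1)) ≤ 2 * l * (m + J + h) + n * (l * (l - 1)) := by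
    rw [← hsum]
    exact Nat.mul_le_mul_left 2 hJ
  obtain ⟨l, rfl⟩ : ∃ k, l = k + 1 := ⟨l - 1, by omega⟩
  rw [Nat.add_sub_cancel] at hJ'
  have hJR : 2 * (((J : ℝ) + h) * m + J * (m + 1)) ≤
      2 * (l + 1) * (m + J + h) + n * ((l + 1) * l) := by exact_mod_cast hJ'
  have hNR : ((l : ℝ) + 1) * N + p ≤ m + p * (J + 1 + h) := by exact_mod_cast hN
  have hpR : (p : ℝ) = 2 * m + 1 := by exact_mod_cast hp
  have h1R : (n : ℝ) + 1 ≤ 2 * h := by exact_mod_cast h1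
  have h2R : 2 * (h : ℝ) ≤ n + 2 := by exact_mod_cast h2
  have hhlR : (h : ℝ) ≤ l + 1 := by exact_mod_cast hhl
  have hlR : (6 : ℝ) ≤ l + 1 := by exact_mod_cast hl
  have hlpR : ((l : ℝ) + 1) * (l + 1) ≤ p := by exact_mod_cast hlp
  have hplR : (p : ℝ) ≤ (l + 1) * (l + 1) + 2 * (l + 1) := by exact_mod_cast hpl
  have hn0 : (0 : ℝ) ≤ n := Nat.cast_nonneg _
  have hh0 : (0 : ℝ) ≤ h := Nat.cast_nonneg _
  push_cast
  obtain ⟨L, hL⟩ : ∃ L : ℝ, (l : ℝ) + 1 = L := ⟨_, rfl⟩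
  have hl' : (l : ℝ) = L - 1 := by linarith
  rw [hl', sub_add_cancel] at hJR
  simp only [hL] at hNR hhlR hlR hlpR hplR ⊢
  clear hl' hL
  have ha : 2 * ((J : ℝ) + h) * (p - L) ≤
      L * (p - 1) + n * (L * (L - 1)) + h * (p + 1) := by
    have hm : (m : ℝ) = (p - 1) / 2 := by linarith
    rw [hm] at hJR
    linarith
  have hb : 2 * (L * N) ≤ 2 * p * ((J : ℝ) + h) + (p - 1) := by linarith
  have hLp : 0 < (p : ℝ) - L := by nlinarith
  have hp0 : (0 : ℝ) ≤ p := Nat.cast_nonneg _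
  have hc : (2 * (N : ℝ) - p) * (L * (p - L)) ≤
      p * ((n + 1) * (L * (L - 1)) + h * (p + 1) + (p - L)) := by
    have h3 := mul_le_mul_of_nonneg_right hb hLp.le
    have h4 := mul_le_mul_of_nonneg_left ha hp0
    nlinarith
  have hd : (n + 1) * (L * (L - 1)) + h * ((p : ℝ) + 1) + (p - L) ≤
      L * ((n + h + 2) * L + 3) := by
    have h3 : (h + 1) * (p : ℝ) ≤ (h + 1) * (L * L + 2 * L) :=
      mul_le_mul_of_nonneg_left hplR (by linarith)
    have h4 : L * (2 * (h : ℝ)) ≤ L * (n + 2) := mul_le_mul_of_nonneg_left h2R (by linarith)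
    nlinarith
  have he : p * ((n + h + 2) * L + 3) ≤ ((n + h + 2) * (L + 1.2) + 4) * ((p : ℝ) - L) := by
    have h3 : L * L * ((n + h + 2) * 1.2 + 1) ≤ p * ((n + h + 2) * 1.2 + 1) :=
      mul_le_mul_of_nonneg_right hlpR (by positivity)
    have h4 : L * ((n + h + 2) * (L + 1.2) + 4) ≤ L * (L * ((n + h + 2) * 1.2 + 1)) := by
      apply mul_le_mul_of_nonneg_left _ (by linarith)
      nlinarith
    linarith
  have hpos : 0 < L * ((p : ℝ) - L) := mul_pos (by linarith) hLp
  refine le_of_mul_le_mul_right (hc.trans ?_) hpos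
  calc p * ((n + 1) * (L * (L - 1)) + h * ((p : ℝ) + 1) + (p - L))
      ≤ p * (L * ((n + h + 2) * L + 3)) := mul_le_mul_of_nonneg_left hd hp0
    _ = L * (p * ((n + h + 2) * L + 3)) := by ring
    _ ≤ L * (((n + h + 2) * (L + 1.2) + 4) * ((p : ℝ) - L)) :=
        mul_le_mul_of_nonneg_left he (by linarith)
    _ = ((n + 1 + h + 1) * (L + 1.2) + 4) * (L * (p - L)) := by ring

end CharacterSums

section QuadraticCharacterSums

open Polynomial

variable {p : ℕ} [Fact p.Prime]

/-- The complete sum of the quadratic character modulo `p` over the values of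
`∏ c ∈ S, (x + c)`. -/
noncomputable def shiftCharSum (S : Finset (ZMod p)) : ℤ :=
  ∑ x : ZMod p, quadraticChar (ZMod p) (∏ c ∈ S, (x + c))

theorem shiftCharSum_image_sub (S : Finset (ZMod p)) (c₀ : ZMod p) :
    shiftCharSum (S.image fun c => c - c₀) = shiftCharSum S := by
  unfold shiftCharSum
  rw [← Equiv.sum_comp (Equiv.addRight c₀)]
  refine sum_congr rfl fun x _ => ?_
  rw [prod_image fun a _ b _ h => sub_left_injective h]
  congr 1
  refine prod_congr rfl fun c _ => ?_
  simp

theorem shiftCharSum_eq_card_sub_card (S : Finset (ZMod p)) :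
    shiftCharSum S = (#{x : ZMod p | quadraticChar (ZMod p) (∏ c ∈ S, (x + c)) = 1} : ℤ) -
      #{x : ZMod p | quadraticChar (ZMod p) (∏ c ∈ S, (x + c)) = -1} := by
  unfold shiftCharSum
  rw [card_filter, card_filter]
  push_cast
  rw [← sum_sub_distrib]
  refine sum_congr rfl fun x _ => ?_
  rcases eq_or_ne (∏ c ∈ S, (x + c)) 0 with h | h
  · simp [h]
  · rcases quadraticChar_dichotomy h with h | h <;> rw [h] <;> simp

theorem le_card_add_card_add_card (S : Finset (ZMod p)) :
    p ≤ #{x : ZMod p | quadraticChar (ZMod p) (∏ c ∈ S, (x + c)) = 1} +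
      #{x : ZMod p | quadraticChar (ZMod p) (∏ c ∈ S, (x + c)) = -1} + #S := by
  classical
  calc p = #(univ : Finset (ZMod p)) := by rw [card_univ, ZMod.card]
    _ ≤ #(univ.filter (fun x => quadraticChar (ZMod p) (∏ c ∈ S, (x + c)) = 1) ∪
        univ.filter (fun x => quadraticChar (ZMod p) (∏ c ∈ S, (x + c)) = -1) ∪
          S.image fun c => -c) := by
        refine card_le_card fun x _ => ?_
        simp only [mem_union, mem_filter, mem_univ, true_and, mem_image]
        rcases eq_or_ne (∏ c ∈ S, (x + c)) 0 with h | h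
        · obtain ⟨c, hc, h0⟩ := prod_eq_zero_iff.mp h
          exact Or.inr ⟨c, hc, (eq_neg_of_add_eq_zero_left h0).symm⟩
        · exact Or.inl (quadraticChar_dichotomy h)
    _ ≤ _ := (card_union_le _ _).trans (Nat.add_le_add (card_union_le _ _) card_image_le)

theorem two_mul_card_quadraticChar_eq_le (hp2 : p ≠ 2) (S : Finset (ZMod p)) (h0 : 0 ∈ S)
    {h : ℕ} (h1 : #S ≤ 2 * h) (h2 : 2 * h ≤ #S + 1) (hhl : h ≤ p.sqrt) (hl : 6 ≤ p.sqrt)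
    {a : ℤ} (ha : a = 1 ∨ a = -1) :
    2 * (#{x : ZMod p | quadraticChar (ZMod p) (∏ c ∈ S, (x + c)) = a} : ℝ) - p ≤
      (#S + h + 1) * (p.sqrt + 1.2) + 4 := by
  have hpp : p.Prime := Fact.out
  obtain ⟨m, hm⟩ : ∃ m, p = 2 * m + 1 := hpp.odd_of_ne_two hp2
  have hlp : p.sqrt * p.sqrt ≤ p := Nat.sqrt_le p
  have hpl : p ≤ p.sqrt * p.sqrt + 2 * p.sqrt := by
    have := Nat.sqrt_le_add p
    omega
  have hltp : p.sqrt < 2 * m + 1 := hm ▸ Nat.sqrt_lt_self hpp.one_lt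
  have hn : 1 ≤ #S := card_pos.mpr ⟨0, h0⟩
  obtain ⟨J, hJ1, hJ2⟩ := exists_stepanov_parameter m #S h p.sqrt hltp hhl
  refine two_mul_sub_le_of_stepanov hm hn h1 h2 hhl hl hlp hpl hJ2 ?_
  set f : (ZMod p)[X] := ∏ c ∈ S, (X + C c) with hf
  have hfn : f.natDegree = #S := by
    rw [hf, natDegree_prod_of_monic _ _ fun c _ => monic_X_add_C c]
    simp
  have heval : ∀ x, f.eval x = ∏ c ∈ S, (x + c) := fun x => by
    simp [hf, eval_prod]
  refine stepanov_mul_card_le hm (f := f) (u := ∏ c ∈ S.erase 0, (X + C c)) ?_ ?_ ?_ (a : ZMod p)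
    (J := J + 1) ?_ (hm ▸ hltp.le) ?_ _ ?_
  · rw [hf, ← mul_prod_erase S _ h0, C_0, add_zero]
  · rw [coeff_zero_eq_eval_zero, eval_prod, prod_ne_zero_iff]
    intro c hc
    simpa using (mem_erase.mp hc).1
  · rw [hfn]; exact hn
  · rw [hfn]
    have : #S * m ≤ p * h := by
      calc #S * m ≤ 2 * h * m := Nat.mul_le_mul_right _ h1
        _ ≤ p * h := by rw [hm]; nlinarith
    rw [mul_add p (J + 1) h]
    omega
  · rw [hfn]; exact hJ1
  · intro x hx
    rw [mem_filter] at hx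
    have hx0 : f.eval x ≠ 0 := by
      intro h
      rw [← heval, h] at hx
      rcases ha with rfl | rfl <;> simp at hx
    refine ⟨hx0, ?_⟩
    rw [← hx.2, quadraticChar_eq_pow_of_char_ne_two' (by rwa [ZMod.ringChar_zmod_n]), ZMod.card,
      heval]
    congr 1
    omega

theorem abs_shiftCharSum_le (hp2 : p ≠ 2) (S : Finset (ZMod p)) (hS : S.Nonempty)
    (hSp : #S ≤ p.sqrt) (hl : 6 ≤ p.sqrt) :
    |(shiftCharSum S : ℝ)| ≤ 1.5 * (#S + 1) * (√p + 1.2) + 4 + #S := by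
  obtain ⟨c₀, hc₀⟩ := hS
  have hcard : #(S.image fun c => c - c₀) = #S := card_image_of_injective _ sub_left_injective
  rw [← shiftCharSum_image_sub S c₀, ← hcard]
  rw [← hcard] at hSp
  have h0 : (0 : ZMod p) ∈ S.image fun c => c - c₀ := mem_image.mpr ⟨c₀, hc₀, sub_self _⟩
  generalize (S.image fun c => c - c₀) = T at *
  have hT : 1 ≤ #T := card_pos.mpr ⟨0, h0⟩
  have hb : ∀ a : ℤ, (a = 1 ∨ a = -1) → _ := fun a ha => two_mul_card_quadraticChar_eq_le hp2 T h0
    (h := (#T + 1) / 2) (by omega) (by omega) (by omega) hl ha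
  have hb1 := hb 1 (Or.inl rfl)
  have hb2 := hb (-1) (Or.inr rfl)
  have hh : (((#T + 1) / 2 : ℕ) : ℝ) ≤ (#T + 1) / 2 := by
    have := @Nat.cast_div_le ℝ _ _ _ (#T + 1) 2
    simpa using this
  have hsq : (p.sqrt : ℝ) ≤ √p := Real.nat_sqrt_le_real_sqrt
  have hW : ((#T : ℝ) + ((#T + 1) / 2 : ℕ) + 1) * (p.sqrt + 1.2) ≤
      1.5 * (#T + 1) * (√p + 1.2) := by
    apply mul_le_mul <;> first | positivity | linarith
  have hle : (p : ℝ) ≤ ((_ + _ + _ : ℕ) : ℝ) :=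
    Nat.cast_le.mpr (le_card_add_card_add_card T)
  have heq := congrArg (fun z : ℤ => (z : ℝ)) (shiftCharSum_eq_card_sub_card T)
  push_cast at heq hle
  rw [abs_le]
  constructor <;> linarith

end QuadraticCharacterSums

section SquareCounts

variable {p : ℕ} [Fact p.Prime]

theorem shiftCharSum_empty : shiftCharSum (∅ : Finset (ZMod p)) = p := by
  simp [shiftCharSum]

theorem shiftCharSum_singleton (hp2 : p ≠ 2) (c : ZMod p) :
    shiftCharSum ({c} : Finset (ZMod p)) = 0 := by
  simp only [shiftCharSum, prod_singleton]
  refine (Equiv.sum_comp (Equiv.addRight c) fun x => quadraticChar (ZMod p) x).trans ?_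
  exact quadraticChar_sum_zero (by rwa [ZMod.ringChar_zmod_n])

theorem shiftCharSum_pair (hp2 : p ≠ 2) {a b : ZMod p} (hab : a ≠ b) :
    shiftCharSum ({a, b} : Finset (ZMod p)) = -1 := by
  have hd : b - a ≠ 0 := sub_ne_zero.mpr hab.symm
  simp only [shiftCharSum, prod_pair hab]
  have h1 : ∑ x : ZMod p, quadraticChar (ZMod p) ((x + a) * (x + b)) =
      ∑ y : ZMod p, (quadraticChar (ZMod p) (1 + (b - a) * y⁻¹) - if y = 0 then 1 else 0) := by
    refine Fintype.sum_equiv (Equiv.addRight a) _ _ fun x => ?_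
    by_cases hx : x + a = 0
    · simp [hx]
    · rw [if_neg (show ¬ Equiv.addRight a x = 0 from hx), sub_zero, Equiv.coe_addRight]
      have : (x + a) * (x + b) = (x + a) ^ 2 * (1 + (b - a) * (x + a)⁻¹) := by
        field_simp
        ring
      rw [this, map_mul, quadraticChar_sq_one' hx, one_mul]
  have h2 : ∑ y : ZMod p, quadraticChar (ZMod p) (1 + (b - a) * y⁻¹) = 0 := by
    rw [Fintype.sum_equiv ((Equiv.inv (ZMod p)).trans
      ((Equiv.mulLeft₀ _ hd).trans (Equiv.addLeft 1))) _ (fun x => quadraticChar (ZMod p) x)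
      fun x => by simp]
    exact quadraticChar_sum_zero (by rwa [ZMod.ringChar_zmod_n])
  rw [h1, sum_sub_distrib, h2]
  simp

theorem abs_shiftCharSum_le_one (hp2 : p ≠ 2) (S : Finset (ZMod p)) (hS : S.Nonempty)
    (hS2 : #S ≤ 2) : |(shiftCharSum S : ℝ)| ≤ 1 := by
  have h1 : 1 ≤ #S := card_pos.mpr hS
  rcases (by omega : #S = 1 ∨ #S = 2) with h | h
  · obtain ⟨c, rfl⟩ := card_eq_one.mp h
    simp [shiftCharSum_singleton hp2]
  · obtain ⟨a, b, hab, rfl⟩ := card_eq_two.mp h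
    simp [shiftCharSum_pair hp2 hab]

/-- The number of `x` modulo `p` for which all the shifts `x + c`, `c ∈ C`, are squares. -/
noncomputable def squareShiftCount (C : Finset (ZMod p)) : ℕ :=
  #{x : ZMod p | ∀ c ∈ C, IsSquare (x + c)}

theorem squareShiftCount_anti {C D : Finset (ZMod p)} (h : C ⊆ D) :
    squareShiftCount D ≤ squareShiftCount C :=
  card_le_card fun x hx => by
    rw [mem_filter] at hx ⊢
    exact ⟨hx.1, fun c hc => hx.2 c (h hc)⟩

theorem abs_indicator_sub_prod_le (C : Finset (ZMod p)) (x : ZMod p) :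
    |(2 : ℤ) ^ #C * (if ∀ c ∈ C, IsSquare (x + c) then 1 else 0) -
      ∏ c ∈ C, (1 + quadraticChar (ZMod p) (x + c))| ≤
      2 ^ #C * ∑ c ∈ C, if x + c = 0 then 1 else 0 := by
  have hrange : ∀ y : ZMod p, 0 ≤ 1 + quadraticChar (ZMod p) y ∧
      1 + quadraticChar (ZMod p) y ≤ 2 := by
    intro y
    rcases eq_or_ne y 0 with rfl | hy
    · simp
    · rcases quadraticChar_dichotomy hy with h | h <;> rw [h] <;> norm_num
  have hP0 : 0 ≤ ∏ c ∈ C, (1 + quadraticChar (ZMod p) (x + c)) :=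
    prod_nonneg fun c _ => (hrange _).1
  have hP1 : ∏ c ∈ C, (1 + quadraticChar (ZMod p) (x + c)) ≤ 2 ^ #C := by
    rw [← prod_const]
    exact prod_le_prod (fun c _ => (hrange _).1) fun c _ => (hrange _).2
  by_cases hz : ∃ c ∈ C, x + c = 0
  · obtain ⟨c, hc, h0⟩ := hz
    have h1 : (1 : ℤ) ≤ ∑ c ∈ C, if x + c = 0 then 1 else 0 := by
      have := single_le_sum (f := fun c => if x + c = 0 then (1 : ℤ) else 0)
        (fun i _ => by split_ifs <;> norm_num) hc
      simpa [h0] using this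
    have h2 : (2 : ℤ) ^ #C * 1 ≤ 2 ^ #C * ∑ c ∈ C, if x + c = 0 then 1 else 0 :=
      mul_le_mul_of_nonneg_left h1 (by positivity)
    refine le_trans ?_ h2
    rw [abs_le]
    split_ifs <;> constructor <;> linarith [pow_pos (show (0 : ℤ) < 2 by norm_num) #C]
  · push Not at hz
    split_ifs with h
    · rw [prod_congr rfl fun c hc => by
        rw [(quadraticChar_one_iff_isSquare (hz c hc)).mpr (h c hc)], prod_const]
      norm_num
    · push Not at h
      obtain ⟨c, hc, hsq⟩ := h
      rw [prod_eq_zero hc (by rw [quadraticChar_neg_one_iff_not_isSquare.mpr hsq]; norm_num)]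
      simp

theorem abs_squareShiftCount_sub_le (C : Finset (ZMod p)) :
    |(squareShiftCount C : ℝ) - p / 2 ^ #C| ≤
      #C + (∑ S ∈ C.powerset.erase ∅, |(shiftCharSum S : ℝ)|) / 2 ^ #C := by
  have hsum : ∑ x : ZMod p, ∏ c ∈ C, (1 + quadraticChar (ZMod p) (x + c)) =
      p + ∑ S ∈ C.powerset.erase ∅, shiftCharSum S := by
    rw [← shiftCharSum_empty (p := p), add_sum_erase _ _ (empty_mem_powerset C)]
    simp only [shiftCharSum, map_prod, prod_one_add]
    exact sum_comm
  have hdiff : |(2 : ℤ) ^ #C * squareShiftCount C -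
      (p + ∑ S ∈ C.powerset.erase ∅, shiftCharSum S)| ≤ 2 ^ #C * #C := by
    rw [← hsum, squareShiftCount, card_filter]
    push_cast
    rw [mul_sum, ← sum_sub_distrib]
    refine (abs_sum_le_sum_abs _ _).trans
      ((sum_le_sum fun x _ => abs_indicator_sub_prod_le C x).trans (le_of_eq ?_))
    rw [← mul_sum, sum_comm]
    congr 1
    rw [card_eq_sum_ones]
    push_cast
    refine sum_congr rfl fun c _ => ?_
    simp [add_eq_zero_iff_eq_neg]
  have hR : |(2 : ℝ) ^ #C * squareShiftCount C -
      (p + ∑ S ∈ C.powerset.erase ∅, (shiftCharSum S : ℝ))| ≤ 2 ^ #C * #C := by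
    exact_mod_cast hdiff
  have habs := abs_sum_le_sum_abs (fun S => (shiftCharSum S : ℝ)) (C.powerset.erase ∅)
  have h2 : (0 : ℝ) < 2 ^ #C := by positivity
  have : (squareShiftCount C : ℝ) - p / 2 ^ #C =
      (2 ^ #C * squareShiftCount C - p) / 2 ^ #C := by field_simp
  rw [this, abs_div, abs_of_pos h2, div_le_iff₀ h2, add_mul, div_mul_cancel₀ _ h2.ne']
  rw [abs_le] at *
  constructor <;> linarith

end SquareCounts

section LocalBound

theorem sum_choose_mul_charBound_le {ν : ℕ} (hν : 3 ≤ ν) {s : ℝ} (hs : 11 ≤ s)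
    (hνs : 4 * ν - 1 ≤ s) :
    ν + (∑ n ∈ range (ν + 1), (ν.choose n : ℝ) *
      (if n ≤ 2 then 1 else 1.5 * (n + 1) * (s + 1.2) + 4 + n)) / 2 ^ ν ≤ ν * s := by
  rcases le_or_gt 10 ν with h10 | h10
  · have hν' : (10 : ℝ) ≤ ν := by exact_mod_cast h10
    have h2 : (0 : ℝ) < 2 ^ ν := by positivity
    have hsum : ∑ n ∈ range (ν + 1), (ν.choose n : ℝ) = 2 ^ ν := by
      exact_mod_cast Nat.sum_range_choose ν
    have hsum' : ∑ n ∈ range (ν + 1), (n : ℝ) * ν.choose n = ν * 2 ^ ν / 2 := by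
      have h := Nat.sum_range_mul_choose ν
      have h' : ∑ n ∈ range (ν + 1), (n : ℝ) * ν.choose n = ν * 2 ^ (ν - 1) := by
        exact_mod_cast h
      rw [h', mul_div_assoc]
      congr 1
      rw [eq_div_iff two_ne_zero, ← pow_succ, Nat.sub_add_cancel (by omega)]
    have hle : ∑ n ∈ range (ν + 1), (ν.choose n : ℝ) *
        (if n ≤ 2 then 1 else 1.5 * (n + 1) * (s + 1.2) + 4 + n) ≤
        ∑ n ∈ range (ν + 1), ((1.5 * (s + 1.2) + 4) * (ν.choose n : ℝ) +
          (1.5 * (s + 1.2) + 1) * (n * ν.choose n)) := by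
      refine sum_le_sum fun n _ => ?_
      have : (if n ≤ 2 then 1 else 1.5 * (n + 1) * (s + 1.2) + 4 + n : ℝ) ≤
          1.5 * (n + 1) * (s + 1.2) + 4 + n := by
        split_ifs
        · have : (0 : ℝ) ≤ 1.5 * (n + 1) * (s + 1.2) := by positivity
          have : (0 : ℝ) ≤ n := by positivity
          linarith
        · exact le_rfl
      calc _ ≤ (ν.choose n : ℝ) * (1.5 * (n + 1) * (s + 1.2) + 4 + n) :=
            mul_le_mul_of_nonneg_left this (by positivity)
        _ = _ := by ring
    rw [sum_add_distrib, ← mul_sum, ← mul_sum, hsum, hsum'] at hle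
    have : (∑ n ∈ range (ν + 1), (ν.choose n : ℝ) *
        (if n ≤ 2 then 1 else 1.5 * (n + 1) * (s + 1.2) + 4 + n)) / 2 ^ ν ≤
        (1.5 * (s + 1.2) + 4) + (1.5 * (s + 1.2) + 1) * (ν / 2) := by
      rw [div_le_iff₀ h2]
      linarith
    nlinarith
  · interval_cases ν <;> norm_num [sum_range_succ, Nat.choose] at hνs ⊢ <;> linarith

variable {p : ℕ} [Fact p.Prime]

theorem squareShiftCount_empty : squareShiftCount (∅ : Finset (ZMod p)) = p := by
  simp [squareShiftCount]

theorem squareShiftCount_two (C : Finset (ZMod 2)) : squareShiftCount C = 2 := by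
  have h : ∀ x : ZMod 2, IsSquare x := by decide
  simp [squareShiftCount, h]

theorem abs_squareShiftCount_sub_le_of_card_le_two (hp2 : p ≠ 2) (C : Finset (ZMod p))
    (hC : #C ≤ 2) : |(squareShiftCount C : ℝ) - p / 2 ^ #C| ≤ #C + (2 ^ #C - 1) / 2 ^ #C := by
  refine (abs_squareShiftCount_sub_le C).trans ?_
  have h1 : ∑ S ∈ C.powerset.erase ∅, |(shiftCharSum S : ℝ)| ≤ 2 ^ #C - 1 := by
    calc _ ≤ ∑ S ∈ C.powerset.erase ∅, (1 : ℝ) := by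
          refine sum_le_sum fun S hS => ?_
          rw [mem_erase, mem_powerset] at hS
          exact abs_shiftCharSum_le_one hp2 S (nonempty_iff_ne_empty.mpr hS.1)
            ((card_le_card hS.2).trans hC)
      _ = 2 ^ #C - 1 := by
          rw [sum_const, card_erase_of_mem (empty_mem_powerset C), card_powerset, nsmul_eq_mul,
            Nat.cast_sub Nat.one_le_two_pow]
          push_cast
          ring
  gcongr

theorem abs_squareShiftCount_sub_le_mul_sqrt (C : Finset (ZMod p)) :
    |(squareShiftCount C : ℝ) - p / 2 ^ #C| ≤ #C * √p := by
  have hp := Fact.out (p := p.Prime)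
  rcases eq_or_ne p 2 with rfl | hp2
  · rw [squareShiftCount_two]
    have hs : (1 : ℝ) ≤ √((2 : ℕ) : ℝ) := Real.one_le_sqrt.mpr (by norm_num)
    have h2 : (1 : ℝ) ≤ 2 ^ #C := one_le_pow₀ (by norm_num)
    have h3 : (2 : ℝ) / 2 ^ #C ≤ 2 := div_le_self (by norm_num) h2
    have h4 : (0 : ℝ) ≤ 2 / 2 ^ #C := by positivity
    push_cast at hs ⊢
    rw [abs_of_nonneg (by linarith)]
    rcases (by omega : #C = 0 ∨ #C = 1 ∨ 2 ≤ #C) with h | h | h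
    · simp [h]
    · rw [h]
      norm_num
    · have : (2 : ℝ) ≤ #C := by exact_mod_cast h
      nlinarith
  have hp3 : 3 ≤ p := by have := hp.two_le; omega
  have hp3' : (3 : ℝ) ≤ p := by exact_mod_cast hp3
  set s : ℝ := √p with hs
  have hsq : s ^ 2 = p := Real.sq_sqrt (by positivity)
  have hs0 : 0 ≤ s := Real.sqrt_nonneg _
  have hs3 : 1.7 ≤ s := Real.le_sqrt_of_sq_le (by norm_num; linarith)
  rcases (by omega : #C = 0 ∨ #C = 1 ∨ #C = 2 ∨ 3 ≤ #C) with h | h | h | h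
  · rw [card_eq_zero.mp h, squareShiftCount_empty]
    simp
  · have := abs_squareShiftCount_sub_le_of_card_le_two hp2 C (by omega)
    rw [h] at this ⊢
    norm_num at this ⊢
    linarith
  · have := abs_squareShiftCount_sub_le_of_card_le_two hp2 C h.le
    rw [h] at this ⊢
    norm_num at this ⊢
    linarith
  have hν : (3 : ℝ) ≤ #C := by exact_mod_cast h
  by_cases htriv : s ^ 2 + 11 ≤ 4 * #C * s
  · obtain ⟨D, hDC, hD⟩ := exists_subset_card_eq (show 2 ≤ #C by omega)
    have h1 := abs_squareShiftCount_sub_le_of_card_le_two hp2 D hD.le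
    rw [hD] at h1
    have h2 : (squareShiftCount C : ℝ) ≤ squareShiftCount D := by
      exact_mod_cast squareShiftCount_anti hDC
    have h3 : (p : ℝ) / 2 ^ #C ≤ p / 4 := by
      gcongr
      calc (4 : ℝ) = 2 ^ 2 := by norm_num
        _ ≤ 2 ^ #C := pow_le_pow_right₀ (by norm_num) (by omega)
    have h4 : (0 : ℝ) ≤ p / 2 ^ #C := by positivity
    have h5 : (0 : ℝ) ≤ squareShiftCount C := by positivity
    rw [abs_le] at h1 ⊢
    norm_num at h1
    constructor <;> linarith [h1.2]
  · have hs11 : 11 ≤ s := by nlinarith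
    have hνs : 4 * (#C : ℝ) - 1 ≤ s := by nlinarith
    have hsqrt : s < p.sqrt + 1 := by
      rw [hs, Real.sqrt_lt' (by positivity)]
      exact_mod_cast (by simpa [sq] using Nat.lt_succ_sqrt p)
    have hC : #C ≤ p.sqrt := by
      have : (#C : ℝ) < p.sqrt + 1 := by linarith
      exact Nat.lt_succ_iff.mp (by exact_mod_cast this)
    have hl : 6 ≤ p.sqrt := by
      have : (6 : ℝ) < p.sqrt + 1 := by linarith
      exact Nat.lt_succ_iff.mp (by exact_mod_cast this)
    refine (abs_squareShiftCount_sub_le C).trans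
      (le_trans ?_ (sum_choose_mul_charBound_le h hs11 hνs))
    gcongr
    set b : ℕ → ℝ := fun n => if n ≤ 2 then 1 else 1.5 * (n + 1) * (s + 1.2) + 4 + n with hb
    have hb0 : ∀ n, 0 ≤ b n := fun n => by
      simp only [hb]
      split_ifs <;> positivity
    calc ∑ S ∈ C.powerset.erase ∅, |(shiftCharSum S : ℝ)|
        ≤ ∑ S ∈ C.powerset.erase ∅, b #S := by
          refine sum_le_sum fun S hS => ?_
          rw [mem_erase, mem_powerset] at hS
          have hne := nonempty_iff_ne_empty.mpr hS.1
          simp only [hb]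
          split_ifs with h2
          · exact abs_shiftCharSum_le_one hp2 S hne h2
          · exact abs_shiftCharSum_le hp2 S hne ((card_le_card hS.2).trans hC) hl
      _ ≤ ∑ S ∈ C.powerset, b #S :=
          sum_le_sum_of_subset_of_nonneg (erase_subset _ _) fun S _ _ => hb0 _
      _ = _ := by
          rw [sum_powerset_apply_card]
          simp only [hb, nsmul_eq_mul]

end LocalBound

section SquarefreeModulus

/-- The number of residues `x` modulo `m` for which all the shifts `x + c`, `c ∈ C`, are
squares. -/
noncomputable def shiftedSquareCount (m : ℕ) (C : Finset ℕ) : ℕ :=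
  Nat.card {x : ZMod m // ∀ c ∈ C, IsSquare (x + (c : ZMod m))}

theorem shiftedSquareCount_mul (C : Finset ℕ) {m n : ℕ} (h : m.Coprime n) :
    shiftedSquareCount (m * n) C = shiftedSquareCount m C * shiftedSquareCount n C := by
  let e := ZMod.chineseRemainder h
  have hsq : ∀ x : ZMod (m * n), IsSquare x ↔ IsSquare (e x).1 ∧ IsSquare (e x).2 := by
    refine fun x => ⟨fun hx => ?_, ?_⟩
    · obtain ⟨y, rfl⟩ := hx
      rw [map_mul]
      exact ⟨⟨_, rfl⟩, ⟨_, rfl⟩⟩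
    · rintro ⟨⟨y, hy⟩, ⟨z, hz⟩⟩
      refine ⟨e.symm (y, z), e.injective ?_⟩
      rw [map_mul, e.apply_symm_apply]
      exact Prod.ext hy hz
  rw [shiftedSquareCount, shiftedSquareCount, shiftedSquareCount, ← Nat.card_prod]
  refine Nat.card_congr ((e.toEquiv.subtypeEquiv fun x => ?_).trans
    (Equiv.subtypeProdEquivProd (p := fun x : ZMod m => ∀ c ∈ C, IsSquare (x + c))
      (q := fun x : ZMod n => ∀ c ∈ C, IsSquare (x + c))))
  rw [← forall₂_and]
  refine forall₂_congr fun c _ => ?_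
  rw [hsq, map_add, map_natCast]
  rfl

theorem shiftedSquareCount_eq_prod (C : Finset ℕ) {m : ℕ} (hm : Squarefree m) :
    shiftedSquareCount m C = ∏ p ∈ m.primeFactors, shiftedSquareCount p C := by
  have h1 : shiftedSquareCount 1 C = 1 := by
    rw [shiftedSquareCount, Nat.card_eq_one_iff_unique]
    exact ⟨inferInstance, ⟨0, fun c _ => ⟨0, Subsingleton.elim _ _⟩⟩⟩
  rw [Nat.multiplicative_factorization (fun m => shiftedSquareCount m C)
    (fun _ _ => shiftedSquareCount_mul C) h1 hm.ne_zero, Finsupp.prod, Nat.support_factorization]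
  refine prod_congr rfl fun p hp => ?_
  rw [Nat.factorization_eq_one_of_squarefree hm (Nat.prime_of_mem_primeFactors hp)
    (Nat.dvd_of_mem_primeFactors hp), pow_one]

theorem abs_shiftedSquareCount_prime_sub_le {p : ℕ} (hp : p.Prime) (C : Finset ℕ)
    (hC : ∀ c ∈ C, c < p) :
    |(shiftedSquareCount p C : ℝ) - p / 2 ^ #C| ≤ #C * √p := by
  have := Fact.mk hp
  have hcard : #(C.image (Nat.cast : ℕ → ZMod p)) = #C := card_image_of_injOn fun a ha b hb hab => by
    have := (ZMod.natCast_eq_natCast_iff' a b p).mp hab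
    rwa [Nat.mod_eq_of_lt (hC a ha), Nat.mod_eq_of_lt (hC b hb)] at this
  have h := abs_squareShiftCount_sub_le_mul_sqrt (C.image (Nat.cast : ℕ → ZMod p))
  rw [hcard] at h
  convert h using 4
  rw [shiftedSquareCount, squareShiftCount, Nat.card_eq_fintype_card, Fintype.card_subtype]
  simp

theorem abs_prod_one_add_sub_one_le {ι : Type*} (s : Finset ι) (f g : ι → ℝ)
    (h : ∀ i ∈ s, |f i| ≤ g i) : |∏ i ∈ s, (1 + f i) - 1| ≤ ∏ i ∈ s, (1 + g i) - 1 := by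
  classical
  rw [prod_one_add, prod_one_add, ← sum_erase_add _ _ (empty_mem_powerset s),
    ← sum_erase_add _ _ (empty_mem_powerset s), prod_empty, prod_empty, add_sub_cancel_right,
    add_sub_cancel_right]
  refine (abs_sum_le_sum_abs _ _).trans (sum_le_sum fun S hS => ?_)
  rw [abs_prod]
  rw [mem_erase, mem_powerset] at hS
  exact prod_le_prod (fun i _ => abs_nonneg _) fun i hi => h i (hS.2 hi)

theorem Efun_eq_prod_sub_one {m : ℕ} (hm : Squarefree m) (ν : ℕ) :
    Efun m ν = ∏ p ∈ m.primeFactors, (1 + ν * 2 ^ ν / √p) - 1 := by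
  let f : ArithmeticFunction ℝ :=
    ⟨fun d => ((ν : ℝ) * 2 ^ ν) ^ #d.primeFactors / √d, by simp⟩
  have hf : f.IsMultiplicative := by
    refine ⟨by simp [f], fun {a b} hab => ?_⟩
    simp only [f, ArithmeticFunction.coe_mk]
    rw [hab.primeFactors_mul, card_union_of_disjoint hab.disjoint_primeFactors, pow_add,
      Nat.cast_mul, Real.sqrt_mul (Nat.cast_nonneg a), mul_div_mul_comm]
  have h := hf.prodPrimeFactors_one_add_of_squarefree hm
  have h1 : m.divisors.filter (fun d => 1 < d) = m.divisors.erase 1 := by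
    ext d
    rw [mem_filter, mem_erase, and_comm]
    refine and_congr_left fun hd => ?_
    have := Nat.pos_of_mem_divisors hd
    omega
  rw [Efun, h1, eq_sub_iff_add_eq]
  have hf1 : f 1 = 1 := hf.1
  rw [← hf1]
  refine (sum_erase_add _ (fun d => f d) (Nat.one_mem_divisors.mpr hm.ne_zero)).trans ?_
  rw [← h]
  refine prod_congr rfl fun p hp => ?_
  simp [f, (Nat.prime_of_mem_primeFactors hp).primeFactors]

theorem Efun_nonneg (m ν : ℕ) : 0 ≤ Efun m ν := sum_nonneg fun _ _ => by positivity

theorem abs_shiftedSquareCount_sub_le {m : ℕ} (hm : Squarefree m) (C : Finset ℕ)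
    (hC : ∀ c ∈ C, c < m.minFac) :
    |(shiftedSquareCount m C : ℝ) - m * ((1 / 2) ^ #m.primeFactors) ^ #C| ≤
      m * ((1 / 2) ^ #m.primeFactors) ^ #C * Efun m #C := by
  have hprime : ∀ p ∈ m.primeFactors, 0 < (p : ℝ) / 2 ^ #C := fun p hp => by
    have := (Nat.prime_of_mem_primeFactors hp).pos
    positivity
  have hmain : (m : ℝ) * ((1 / 2) ^ #m.primeFactors) ^ #C =
      ∏ p ∈ m.primeFactors, (p : ℝ) / 2 ^ #C := by
    rw [prod_div_distrib, prod_const, ← Nat.cast_prod, Nat.prod_primeFactors_of_squarefree hm,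
      pow_right_comm, ← pow_mul, ← pow_mul, one_div, inv_pow, div_eq_mul_inv, mul_comm #C]
  have hcount : (shiftedSquareCount m C : ℝ) = (∏ p ∈ m.primeFactors, (p : ℝ) / 2 ^ #C) *
      ∏ p ∈ m.primeFactors,
        (1 + ((shiftedSquareCount p C : ℝ) - p / 2 ^ #C) / (p / 2 ^ #C)) := by
    rw [shiftedSquareCount_eq_prod C hm, Nat.cast_prod, ← prod_mul_distrib]
    refine prod_congr rfl fun p hp => ?_
    have := (hprime p hp).ne'
    rw [mul_add, mul_div_cancel₀ _ this]
    ring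
  rw [hmain, hcount, ← mul_sub_one, abs_mul, abs_of_pos (prod_pos hprime),
    Efun_eq_prod_sub_one hm]
  refine mul_le_mul_of_nonneg_left (abs_prod_one_add_sub_one_le _ _ _ fun p hp => ?_)
    (prod_pos hprime).le
  have hpp := Nat.prime_of_mem_primeFactors hp
  have hp0 : (0 : ℝ) < p := by exact_mod_cast hpp.pos
  have h := abs_shiftedSquareCount_prime_sub_le hpp C fun c hc =>
    (hC c hc).trans_le (Nat.minFac_le_of_dvd hpp.two_le (Nat.dvd_of_mem_primeFactors hp))
  rw [abs_div, abs_of_pos (hprime p hp), div_le_iff₀ (hprime p hp)]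
  refine h.trans (le_of_eq ?_)
  have hs : √(p : ℝ) ≠ 0 := (Real.sqrt_pos.mpr hp0).ne'
  field_simp
  rw [Real.sq_sqrt hp0.le]

end SquarefreeModulus

section InclusionExclusion

theorem abs_ite_sub_alternating_sum_choose_le (u : ℕ) {r : ℕ} (hr : 0 < r) :
    |(if u = 0 then 1 else 0 : ℝ) - ∑ k ∈ range r, (-1) ^ k * (u.choose k : ℝ)| ≤ u.choose r := by
  obtain ⟨r, rfl⟩ := Nat.exists_eq_succ_of_ne_zero hr.ne'
  rcases u with _ | u
  · simp [sum_range_succ']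
  · have h : ∑ k ∈ range (r + 1), (-1 : ℝ) ^ k * ((u + 1).choose k : ℝ) =
        (-1) ^ r * u.choose r := by
      exact_mod_cast Int.alternating_sum_range_choose_eq_choose (n := u) (m := r)
    rw [Nat.succ_eq_add_one, h, if_neg (by omega), zero_sub, abs_neg, abs_mul, abs_pow, abs_neg,
      abs_one, one_pow, one_mul, abs_of_nonneg (by positivity), Nat.choose_succ_succ]
    push_cast
    linarith [Nat.cast_nonneg (α := ℝ) (u.choose (r + 1))]

theorem abs_one_sub_pow_sub_le (n r : ℕ) {q : ℝ} (hq : 0 ≤ q) :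
    |∑ k ∈ range r, (-1) ^ k * ((n.choose k : ℝ) * q ^ k) - (1 - q) ^ n| ≤
      ∑ k ∈ Icc r n, (n.choose k : ℝ) * q ^ k := by
  have hpow : (1 - q) ^ n = ∑ k ∈ range (max r (n + 1)), (-1) ^ k * ((n.choose k : ℝ) * q ^ k) := by
    rw [show 1 - q = -q + 1 by ring, add_pow]
    refine (sum_congr rfl fun k _ => ?_).trans
      (sum_subset (range_subset_range.mpr (le_max_right _ _)) fun k _ hk => ?_)
    · rw [one_pow, neg_pow]
      ring
    · rw [Nat.choose_eq_zero_of_lt (by simpa using hk)]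
      simp
  have hsplit := sum_sdiff (f := fun k => (-1) ^ k * ((n.choose k : ℝ) * q ^ k))
    (range_subset_range.mpr (le_max_left r (n + 1)))
  have hset : range (max r (n + 1)) \ range r = Icc r n := by
    ext k
    simp only [mem_sdiff, mem_range, mem_Icc]
    omega
  rw [hpow, ← hsplit, hset, sub_add_cancel_right, abs_neg]
  refine (abs_sum_le_sum_abs _ _).trans (le_of_eq (sum_congr rfl fun k _ => ?_))
  rw [abs_mul, abs_pow, abs_neg, abs_one, one_pow, one_mul, abs_of_nonneg (by positivity)]

end InclusionExclusion

section NonresidueCounts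

theorem univM_eq_univ (m : ℕ) [NeZero m] : univM m = univ := by
  ext x
  simp only [univM, mem_image, mem_range, mem_univ, iff_true]
  exact ⟨x.val, ZMod.val_lt x, ZMod.natCast_zmod_val x⟩

theorem mem_QR_iff_isSquare {m : ℕ} [NeZero m] {x : ZMod m} : x ∈ QR m ↔ IsSquare x := by
  simp only [QR, mem_image, mem_range]
  constructor
  · rintro ⟨a, _, rfl⟩
    exact ⟨a, sq _⟩
  · rintro ⟨y, rfl⟩
    exact ⟨y.val, ZMod.val_lt y, by rw [ZMod.natCast_zmod_val, sq]⟩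

open scoped Classical in
theorem sum_choose_card_filter_isSquare (m : ℕ) [NeZero m] (C₁ C₂ : Finset ℕ) (k : ℕ) :
    ∑ x : ZMod m with ∀ c ∈ C₁, IsSquare (x + (c : ZMod m)),
      (#{c ∈ C₂ | IsSquare (x + ((c : ℕ) : ZMod m))}).choose k =
    ∑ T ∈ C₂.powersetCard k, shiftedSquareCount m (C₁ ∪ T) := by
  have h1 : ∀ x : ZMod m, (#{c ∈ C₂ | IsSquare (x + ((c : ℕ) : ZMod m))}).choose k =
      #{T ∈ C₂.powersetCard k | ∀ c ∈ T, IsSquare (x + ((c : ℕ) : ZMod m))} := by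
    intro x
    rw [← card_powersetCard]
    congr 1
    ext T
    simp only [mem_powersetCard, mem_filter, subset_iff]
    grind
  have h2 : ∀ T, shiftedSquareCount m (C₁ ∪ T) =
      #{x ∈ ({x | ∀ c ∈ C₁, IsSquare (x + (c : ZMod m))} : Finset (ZMod m)) |
        ∀ c ∈ T, IsSquare (x + ((c : ℕ) : ZMod m))} := by
    intro T
    rw [shiftedSquareCount, Nat.card_eq_fintype_card, Fintype.card_subtype, filter_filter]
    simp only [mem_union, or_imp, forall_and]
  simp only [h1, h2]
  exact sum_card_bipartiteAbove_eq_sum_card_bipartiteBelow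
    fun (x : ZMod m) (T : Finset ℕ) => ∀ c ∈ T, IsSquare (x + ((c : ℕ) : ZMod m))

open scoped Classical in
theorem abs_card_RNset_sub_alternating_sum_le (m : ℕ) [NeZero m] (C₁ C₂ : Finset ℕ) {r : ℕ}
    (hr : 0 < r) :
    |(#(RNset m C₁ C₂) : ℝ) - ∑ k ∈ range r, (-1) ^ k *
      ∑ T ∈ C₂.powersetCard k, (shiftedSquareCount m (C₁ ∪ T) : ℝ)| ≤
    ∑ T ∈ C₂.powersetCard r, (shiftedSquareCount m (C₁ ∪ T) : ℝ) := by
  set X : Finset (ZMod m) := {x | ∀ c ∈ C₁, IsSquare (x + (c : ZMod m))} with hX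
  let u : ZMod m → ℕ := fun x => #{c ∈ C₂ | IsSquare (x + ((c : ℕ) : ZMod m))}
  have hS : ∀ k, ∑ T ∈ C₂.powersetCard k, (shiftedSquareCount m (C₁ ∪ T) : ℝ) =
      ∑ x ∈ X, ((u x).choose k : ℝ) := fun k => by
    exact_mod_cast (sum_choose_card_filter_isSquare m C₁ C₂ k).symm
  have hRN : (#(RNset m C₁ C₂) : ℝ) = ∑ x ∈ X, if u x = 0 then 1 else 0 := by
    rw [RNset, univM_eq_univ, sum_boole]
    congr 2
    ext x
    simp [hX, u, mem_QR_iff_isSquare, filter_eq_empty_iff]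
  simp only [hS, hRN, mul_sum]
  rw [sum_comm, ← sum_sub_distrib]
  exact (abs_sum_le_sum_abs _ _).trans
    (sum_le_sum fun x _ => abs_ite_sub_alternating_sum_choose_le (u x) hr)

theorem abs_sum_shiftedSquareCount_sub_le {m : ℕ} (hm : Squarefree m) {C₁ C₂ : Finset ℕ}
    (hdisj : Disjoint C₁ C₂) (h₁ : ∀ c ∈ C₁, c < m.minFac) (h₂ : ∀ c ∈ C₂, c < m.minFac)
    {q : ℝ} (hq : q = (1 / 2) ^ #m.primeFactors) (k : ℕ) :
    |∑ T ∈ C₂.powersetCard k, (shiftedSquareCount m (C₁ ∪ T) : ℝ) -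
        m * q ^ #C₁ * ((#C₂).choose k * q ^ k)| ≤
      m * q ^ #C₁ * ((#C₂).choose k * q ^ k * Efun m (#C₁ + k)) := by
  have hconst : ∀ a : ℝ, ((#C₂).choose k : ℝ) * a = ∑ T ∈ C₂.powersetCard k, a := fun a => by
    rw [sum_const, card_powersetCard, nsmul_eq_mul]
  have e1 : m * q ^ #C₁ * ((#C₂).choose k * q ^ k) =
      (#C₂).choose k * (m * q ^ (#C₁ + k)) := by ring
  have e2 : m * q ^ #C₁ * ((#C₂).choose k * q ^ k * Efun m (#C₁ + k)) =
      (#C₂).choose k * (m * q ^ (#C₁ + k) * Efun m (#C₁ + k)) := by ring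
  rw [e1, e2, hconst, hconst, ← sum_sub_distrib]
  refine (abs_sum_le_sum_abs _ _).trans (sum_le_sum fun T hT => ?_)
  rw [mem_powersetCard] at hT
  have hcard : #(C₁ ∪ T) = #C₁ + k := by
    rw [card_union_of_disjoint (disjoint_of_subset_right hT.1 hdisj), hT.2]
  have h := abs_shiftedSquareCount_sub_le hm (C₁ ∪ T) fun c hc => by
    rcases mem_union.mp hc with hc | hc
    exacts [h₁ c hc, h₂ c (hT.1 hc)]
  rwa [hcard, ← hq] at h

end NonresidueCounts

/-- Lemma 2.3: for `m` square-free with least prime factor `p₁` and `t = ω(m)`, and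
disjoint sets `C₁, C₂` of non-negative integers below `p₁`, for every `r ≥ 1`:
`||RN_m(C₁,C₂)| - m·2^(-s₁t)·(1-2^(-t))^(s₂)| ≤ K·m·2^(-s₁t)·(E₁ + E₂)`
with `K` absolute, where `E₁ = Σ_(k=0)^(min(r,s₂)) C(s₂,k)·2^(-kt)·E(s₁+k)` and
`E₂ = Σ_(k=r)^(s₂) C(s₂,k)·2^(-kt)`. -/
theorem stmt_8 :
    ∃ K : ℝ, 0 < K ∧
      ∀ m : ℕ, Squarefree m →
        ∀ C₁ C₂ : Finset ℕ, Disjoint C₁ C₂ →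
          (∀ c ∈ C₁, c < m.minFac) → (∀ c ∈ C₂, c < m.minFac) →
          ∀ r : ℕ, 0 < r →
            |((RNset m C₁ C₂).card : ℝ) -
                (m : ℝ) * (2 : ℝ) ^ (-((C₁.card : ℤ) * m.primeFactors.card)) *
                  (1 - (2 : ℝ) ^ (-(m.primeFactors.card : ℤ))) ^ C₂.card| ≤
              K * m * (2 : ℝ) ^ (-((C₁.card : ℤ) * m.primeFactors.card)) *
                ((∑ k ∈ Finset.range (min r C₂.card + 1),
                    (C₂.card.choose k : ℝ) * (2 : ℝ) ^ (-((k : ℤ) * m.primeFactors.card)) *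
                      Efun m (C₁.card + k)) +
                  ∑ k ∈ Finset.Icc r C₂.card,
                    (C₂.card.choose k : ℝ) *
                      (2 : ℝ) ^ (-((k : ℤ) * m.primeFactors.card))) := by
  refine ⟨2, two_pos, fun m hm C₁ C₂ hdisj h₁ h₂ r hr => ?_⟩
  have : NeZero m := ⟨hm.ne_zero⟩
  obtain ⟨q, hq⟩ : ∃ q : ℝ, q = (1 / 2) ^ #m.primeFactors := ⟨_, rfl⟩
  have hq0 : 0 ≤ q := by rw [hq]; positivity
  have hpow : ∀ k : ℕ, (2 : ℝ) ^ (-((k : ℤ) * #m.primeFactors)) = q ^ k := fun k => by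
    rw [zpow_neg, hq, one_div, inv_pow, inv_pow, ← pow_mul, mul_comm]
    norm_cast
  have hpow1 : (2 : ℝ) ^ (-(#m.primeFactors : ℤ)) = q := by simpa using hpow 1
  simp only [hpow, hpow1]
  set n := #C₂ with hn
  set M : ℝ := m * q ^ #C₁ with hM
  have hM0 : 0 ≤ M := by positivity
  let S : ℕ → ℝ := fun k => ∑ T ∈ C₂.powersetCard k, (shiftedSquareCount m (C₁ ∪ T) : ℝ)
  let B : ℕ → ℝ := fun k => n.choose k * q ^ k
  let E : ℕ → ℝ := fun k => n.choose k * q ^ k * Efun m (#C₁ + k)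
  have hE0 : ∀ k, 0 ≤ E k := fun k =>
    mul_nonneg (mul_nonneg (Nat.cast_nonneg _) (pow_nonneg hq0 _)) (Efun_nonneg _ _)
  have hB0 : ∀ k, 0 ≤ B k := fun k => mul_nonneg (Nat.cast_nonneg _) (pow_nonneg hq0 _)
  have hS : ∀ k, |S k - M * B k| ≤ M * E k :=
    abs_sum_shiftedSquareCount_sub_le hm hdisj h₁ h₂ hq
  have hbonf : |(#(RNset m C₁ C₂) : ℝ) - ∑ k ∈ range r, (-1) ^ k * S k| ≤ S r :=
    abs_card_RNset_sub_alternating_sum_le m C₁ C₂ hr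
  have hmid : |∑ k ∈ range r, (-1) ^ k * S k - M * ∑ k ∈ range r, (-1) ^ k * B k| ≤
      M * ∑ k ∈ range r, E k := by
    rw [mul_sum, mul_sum, ← sum_sub_distrib]
    refine (abs_sum_le_sum_abs _ _).trans (sum_le_sum fun k _ => ?_)
    rw [mul_left_comm, ← mul_sub, abs_mul, abs_pow, abs_neg, abs_one, one_pow, one_mul]
    exact hS k
  have hmain : |M * ∑ k ∈ range r, (-1) ^ k * B k - M * (1 - q) ^ n| ≤
      M * ∑ k ∈ Icc r n, B k := by
    rw [← mul_sub, abs_mul, abs_of_nonneg hM0]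
    exact mul_le_mul_of_nonneg_left (abs_one_sub_pow_sub_le n r hq0) hM0
  have hBr : M * B r ≤ M * ∑ k ∈ Icc r n, B k := by
    refine mul_le_mul_of_nonneg_left ?_ hM0
    rcases le_or_gt r n with h | h
    · exact single_le_sum (fun k _ => hB0 k) (left_mem_Icc.mpr h)
    · simpa [B, Nat.choose_eq_zero_of_lt h] using sum_nonneg fun k (_ : k ∈ Icc r n) => hB0 k
  have hEr : ∑ k ∈ range r, E k + E r = ∑ k ∈ range (min r n + 1), E k := by
    rw [← sum_range_succ]
    refine (sum_subset (range_subset_range.mpr (by omega)) fun k hk hk' => ?_).symm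
    rw [mem_range] at hk hk'
    simp [E, Nat.choose_eq_zero_of_lt (show n < k by omega)]
  have hEM := mul_nonneg hM0 (sum_nonneg fun k (_ : k ∈ range (min r n + 1)) => hE0 k)
  have hSr := (abs_le.mp (hS r)).2
  have hEr' := congrArg (M * ·) hEr
  simp only [mul_add] at hEr'
  calc _ ≤ 2 * (M * ∑ k ∈ range (min r n + 1), E k + M * ∑ k ∈ Icc r n, B k) := by
        rw [abs_le] at hbonf hmid hmain ⊢
        constructor <;> linarith
    _ = _ := by rw [hM]; ring
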